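/- If θ has the NOF property, then Br(ι(θ)) is a graded poset with rank function ρ: for all u,v ∈ ι(θ) with u ≤ v, every maximal chain of the interval {x ∈ ι(θ) : u ≤ x ≤ v} has exactly ρ(v) − ρ(u) + 1 elements. -/

import Mathlib

namespace TwistedIdentitiesPaper

open scoped Classical

variable {B : Type*} {W : Type*} [Group W] {M : CoxeterMatrix B}

/-- The Bruhat order on `W`, defined via the subword property: `u ≤ v` iff every
reduced expression for `v` contains a subword representing `u`. -/
def bruhatLE (cs : CoxeterSystem M W) (u v : W) : Prop :=
  ∀ l : List B, cs.IsReduced l → cs.wordProd l = v →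
    ∃ l' : List B, l'.Sublist l ∧ cs.wordProd l' = u

/-- The strict Bruhat order. -/
def bruhatLT (cs : CoxeterSystem M W) (u v : W) : Prop :=
  bruhatLE cs u v ∧ u ≠ v

/-- The action `w ↦ w ⋅ s̲ᵢ`: `w ⋅ s̲ᵢ = w sᵢ` if `θ(sᵢ) w sᵢ = w`, and
`w ⋅ s̲ᵢ = θ(sᵢ) w sᵢ` otherwise. -/
noncomputable def twistAct (cs : CoxeterSystem M W) (θ : W ≃* W) (w : W) (i : B) : W :=
  if θ (cs.simple i) * w * cs.simple i = w then w * cs.simple i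
  else θ (cs.simple i) * w * cs.simple i

/-- `e ⋅ s̲₁ ⋯ s̲ₖ` for a word `s₁ ⋯ sₖ`. -/
noncomputable def twistProd (cs : CoxeterSystem M W) (θ : W ≃* W) (l : List B) : W :=
  l.foldl (twistAct cs θ) 1

/-- The set of twisted involutions `I(θ) = {w : θ(w) = w⁻¹}`. -/
def twistedInvolutions (θ : W ≃* W) : Set W := {w | θ w = w⁻¹}

/-- The set of twisted identities `ι(θ) = {θ(w⁻¹) w : w ∈ W}`. -/
def twistedIdentities (θ : W ≃* W) : Set W := {w | ∃ v : W, w = θ v⁻¹ * v}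

/-- The rank `ρ(w)` of a twisted involution: the least `k` such that
`w = e ⋅ s̲₁ ⋯ s̲ₖ`. -/
noncomputable def twistRank (cs : CoxeterSystem M W) (θ : W ≃* W) (w : W) : ℕ :=
  sInf {k | ∃ l : List B, l.length = k ∧ twistProd cs θ l = w}

/-- `θ` has the no-odd-flip (NOF) property: for every `s ∈ S` with `θ(s) ≠ s`,
the order of `s θ(s)` is even or infinite. -/
def NOF (cs : CoxeterSystem M W) (θ : W ≃* W) : Prop :=
  ∀ i : B, θ (cs.simple i) ≠ cs.simple i →
    Even (orderOf (cs.simple i * θ (cs.simple i))) ∨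
      orderOf (cs.simple i * θ (cs.simple i)) = 0


/-- The interval `[u,v]` of `Br(ι(θ))`. -/
def iotaInterval (cs : CoxeterSystem M W) (θ : W ≃* W) (u v : W) : Set W :=
  {x | x ∈ twistedIdentities θ ∧ bruhatLE cs u x ∧ bruhatLE cs x v}

/-- `C` is a maximal chain of the interval `[u,v]` of `Br(ι(θ))`. -/
def IsMaximalChain (cs : CoxeterSystem M W) (θ : W ≃* W) (u v : W) (C : Set W) : Prop :=
  C ⊆ iotaInterval cs θ u v ∧ IsChain (bruhatLE cs) C ∧
    ∀ C' : Set W, C' ⊆ iotaInterval cs θ u v → IsChain (bruhatLE cs) C' → C ⊆ C' → C = C'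

section Coxeter

variable (cs : CoxeterSystem M W)

local notation "s" => cs.simple
local notation "ℓ" => cs.length
local notation "π" => cs.wordProd

/-- The action of a simple reflection on signed group elements `(t, ε)`. -/
noncomputable def signedConj (i : B) : Function.End (W × ZMod 2) :=
  fun x => (s i * x.1 * s i, x.2 + if x.1 = s i then 1 else 0)

theorem signedConj_mul_pow_apply (i j : B) (m : ℕ) (w : W) (ε : ZMod 2) :
    ((signedConj cs i * signedConj cs j) ^ m) (w, ε) =
      ((s i * s j) ^ m * w * ((s i * s j) ^ m)⁻¹,
        ε + ∑ k ∈ Finset.range (2 * m), if w = s j * (s i * s j) ^ k then 1 else 0) := by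
  induction m generalizing w ε with
  | zero => simp [Function.End.one_def]
  | succ m ih =>
    have hstep : (signedConj cs i * signedConj cs j) (w, ε) =
        ((s i * s j) * w * (s i * s j)⁻¹,
          ε + ((if w = s j then 1 else 0) + if w = s j * (s i * s j) then 1 else 0)) := by
      change signedConj cs i (signedConj cs j (w, ε)) = _
      have : (s j * w * s j = s i) ↔ w = s j * (s i * s j) := by
        constructor
        · intro h; rw [← h]; simp [mul_assoc]
        · rintro rfl; simp [mul_assoc]
      simp only [signedConj, this, Prod.mk.injEq]
      constructor
      · simp [mul_assoc]
      · ring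
    rw [pow_succ]
    change ((signedConj cs i * signedConj cs j) ^ m)
      ((signedConj cs i * signedConj cs j) (w, ε)) = _
    rw [hstep, ih]
    have key : ∀ k, (s i * s j * w * (s i * s j)⁻¹ = s j * (s i * s j) ^ k) ↔
        w = s j * (s i * s j) ^ (k + 2) := by
      intro k
      have h1 : (s i * s j)⁻¹ * s j = s j * (s i * s j) := by simp [mul_assoc]
      have h2 : (s i * s j) * s j = s j * (s i * s j)⁻¹ := by simp [mul_assoc]
      generalize s i * s j = c at h1 h2
      constructor
      · intro h
        calc w = c⁻¹ * (c * w * c⁻¹) * c := by group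
          _ = (c⁻¹ * s j) * c ^ k * c := by rw [h]; group
          _ = _ := by rw [h1, pow_succ, pow_succ']; group
      · rintro rfl
        calc _ = (c * s j) * c ^ (k + 2) * c⁻¹ := by group
          _ = s j * (c⁻¹ * (c ^ k * c * c) * c⁻¹) := by rw [h2, pow_succ, pow_succ]; group
          _ = _ := by rw [← pow_succ, pow_succ']; group
    simp only [key, Prod.mk.injEq]
    constructor
    · rw [pow_succ]; group
    · rw [show 2 * (m + 1) = 2 * m + 1 + 1 from by ring, Finset.sum_range_succ',
        Finset.sum_range_succ']
      simp only [zero_add, pow_one, pow_zero, mul_one]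
      ring

theorem isLiftable_signedConj : M.IsLiftable (signedConj cs) := by
  intro i j
  funext ⟨w, ε⟩
  rw [signedConj_mul_pow_apply, cs.simple_mul_simple_pow, two_mul, Finset.sum_range_add]
  simp only [pow_add, cs.simple_mul_simple_pow, one_mul, CharTwo.add_self_eq_zero]
  simp
  rfl

/-- The sign cocycle: `signCocycle cs w t` is the parity of the number of occurrences of `t` in the
right inversion sequence of any word for `w`. -/
noncomputable def signCocycle (w t : W) : ZMod 2 :=
  (cs.lift ⟨signedConj cs, isLiftable_signedConj cs⟩ w (t, 0)).2

theorem lift_signedConj_apply (w t : W) (ε : ZMod 2) :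
    cs.lift ⟨signedConj cs, isLiftable_signedConj cs⟩ w (t, ε) =
      (w * t * w⁻¹, ε + signCocycle cs w t) := by
  unfold signCocycle
  set F := cs.lift ⟨signedConj cs, isLiftable_signedConj cs⟩ with hF
  have hs : ∀ i, F (s i) = signedConj cs i := fun i => cs.lift_apply_simple _ i
  clear_value F
  induction w using cs.simple_induction_left generalizing t ε with
  | one => simp [Function.End.one_def]
  | mul_simple_left w i ih =>
    have h : ∀ x, F (s i * w) x = signedConj cs i (F w x) := by
      intro x; rw [map_mul, hs]; rfl
    rw [h, h, ih t ε, ih t 0]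
    simp only [signedConj, Prod.mk.injEq]
    constructor
    · simp [mul_assoc]
    · ring

theorem signCocycle_mul (x y t : W) :
    signCocycle cs (x * y) t = signCocycle cs y t + signCocycle cs x (y * t * y⁻¹) := by
  have h := lift_signedConj_apply cs (x * y) t 0
  rw [map_mul] at h
  change cs.lift ⟨signedConj cs, isLiftable_signedConj cs⟩ x
    (cs.lift ⟨signedConj cs, isLiftable_signedConj cs⟩ y (t, 0)) = _ at h
  rw [lift_signedConj_apply, lift_signedConj_apply] at h
  simpa using (congrArg Prod.snd h).symm

theorem signCocycle_simple (i : B) (t : W) :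
    signCocycle cs (s i) t = if t = s i then 1 else 0 := by
  unfold signCocycle
  rw [cs.lift_apply_simple]
  simp [signedConj]

theorem signCocycle_one (t : W) : signCocycle cs 1 t = 0 := by
  simp [signCocycle, Function.End.one_def]

theorem signCocycle_inv (w t : W) :
    signCocycle cs w⁻¹ (w * t * w⁻¹) = signCocycle cs w t := by
  have h := signCocycle_mul cs w⁻¹ w t
  rw [inv_mul_cancel, signCocycle_one] at h
  generalize signCocycle cs w t = a at *
  generalize signCocycle cs w⁻¹ (w * t * w⁻¹) = b at *
  revert a b; decide

theorem mem_rightInvSeq_of_signCocycle_ne_zero (l : List B) (t : W)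
    (h : signCocycle cs (π l) t ≠ 0) : t ∈ cs.rightInvSeq l := by
  induction l with
  | nil => simp [signCocycle_one] at h
  | cons i l ih =>
    rw [cs.wordProd_cons, signCocycle_mul, signCocycle_simple] at h
    rw [CoxeterSystem.rightInvSeq, List.mem_cons]
    by_cases h' : π l * t * (π l)⁻¹ = s i
    · left; rw [← h']; group
    · right; exact ih (by simpa [h'] using h)

variable {cs}

theorem signCocycle_conj (x w q : W) :
    signCocycle cs (w * x * w⁻¹) (w * q * w⁻¹) =
      signCocycle cs w q + (signCocycle cs x q + signCocycle cs w (x * q * x⁻¹)) := by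
  rw [signCocycle_mul, signCocycle_inv, signCocycle_mul]
  simp [mul_assoc]

theorem signCocycle_self {t : W} (ht : cs.IsReflection t) : signCocycle cs t t = 1 := by
  obtain ⟨w, i, rfl⟩ := ht
  rw [signCocycle_conj, signCocycle_simple, if_pos rfl, mul_inv_cancel_right]
  generalize signCocycle cs w (s i) = a
  revert a; decide

theorem signCocycle_of_commute {t r : W} (ht : cs.IsReflection t) (hne : r ≠ t)
    (hc : t * r = r * t) : signCocycle cs t r = 0 := by
  obtain ⟨w, i, rfl⟩ := ht
  obtain ⟨q, rfl⟩ : ∃ q, r = w * q * w⁻¹ := ⟨w⁻¹ * r * w, by group⟩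
  have hq : s i * q = q * s i := by
    simpa [mul_assoc] using congrArg (fun x => w⁻¹ * x * w) hc
  have hq1 : q ≠ s i := fun h => hne (by rw [h])
  rw [signCocycle_conj, signCocycle_simple, if_neg hq1, hq, mul_inv_cancel_right]
  simp [CharTwo.add_self_eq_zero]

theorem length_mul_lt_iff {w t : W} (ht : cs.IsReflection t) :
    ℓ (w * t) < ℓ w ↔ signCocycle cs w t = 1 := by
  have key : ∀ x, signCocycle cs x t ≠ 0 → ℓ (x * t) < ℓ x := by
    intro x hx
    obtain ⟨l, hl, rfl⟩ := cs.exists_isReduced x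
    exact (cs.isRightInversion_of_mem_rightInvSeq hl
      (mem_rightInvSeq_of_signCocycle_ne_zero cs l t hx)).2
  constructor
  · intro h
    by_contra h1
    have h2 : signCocycle cs w t = 0 := by
      generalize signCocycle cs w t = a at *
      revert a; decide
    have h3 := key (w * t) (by
      rw [signCocycle_mul, signCocycle_self ht, mul_inv_cancel_right, h2]; decide)
    rw [mul_assoc, ht.mul_self, mul_one] at h3
    omega
  · intro h
    exact key w (by rw [h]; decide)

theorem not_length_mul_lt_iff {w t : W} (ht : cs.IsReflection t) :
    ¬ ℓ (w * t) < ℓ w ↔ signCocycle cs w t = 0 := by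
  rw [length_mul_lt_iff ht]
  generalize signCocycle cs w t = a
  revert a; decide

/-- The strong exchange property. -/
theorem exists_wordProd_eraseIdx {l : List B} {t : W} (ht : cs.IsReflection t)
    (h : ℓ (π l * t) < ℓ (π l)) : ∃ j < l.length, π l * t = π (l.eraseIdx j) := by
  rw [length_mul_lt_iff ht] at h
  have h1 := mem_rightInvSeq_of_signCocycle_ne_zero cs l t (by rw [h]; decide)
  obtain ⟨j, hj, rfl⟩ := List.mem_iff_getElem.mp h1
  refine ⟨j, by simpa using hj, ?_⟩
  rw [← List.getD_eq_getElem _ 1 hj, cs.wordProd_mul_getD_rightInvSeq]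

theorem simple_mul_eq_mul_simple {w : W} {i j : B}
    (h : ¬ (ℓ (s j * w) < ℓ w ↔ ℓ (s j * (w * s i)) < ℓ (w * s i))) : s j * w = w * s i := by
  have hinv : ∀ x, ℓ (s j * x) < ℓ x ↔ signCocycle cs x⁻¹ (s j) = 1 := by
    intro x
    rw [← length_mul_lt_iff (cs.isReflection_simple j), ← cs.length_inv (s j * x),
      ← cs.length_inv x]
    simp
  rw [hinv, hinv, mul_inv_rev, signCocycle_mul, cs.inv_simple, signCocycle_simple, inv_inv] at h
  by_cases h' : w⁻¹ * s j * w = s i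
  · rw [← h']; group
  · simp [h'] at h

theorem length_simple_mul_mul_simple_of_lt {w : W} {i j : B} (hne : s j * w ≠ w * s i)
    (h1 : ℓ (w * s i) < ℓ w) (h2 : ℓ (s j * w) < ℓ w) :
    ℓ (s j * w * s i) + 2 = ℓ w := by
  have h := mt simple_mul_eq_mul_simple hne
  rw [not_not] at h
  have h3 := cs.length_simple_mul (w * s i) j
  have h4 := cs.length_mul_simple w i
  rw [mul_assoc]
  have := h.1 h2
  omega

theorem length_simple_mul_mul_simple_of_gt {w : W} {i j : B} (hne : s j * w ≠ w * s i)
    (h1 : ℓ w < ℓ (w * s i)) (h2 : ℓ w < ℓ (s j * w)) :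
    ℓ (s j * w * s i) = ℓ w + 2 := by
  have h := mt simple_mul_eq_mul_simple hne
  rw [not_not] at h
  have h3 := cs.length_simple_mul (w * s i) j
  have h4 := cs.length_mul_simple w i
  rw [mul_assoc]
  have := mt h.2 (by omega)
  omega

theorem isReduced_append_singleton {l : List B} {i : B} (hl : cs.IsReduced l)
    (h : ℓ (π l) < ℓ (π l * s i)) : cs.IsReduced (l ++ [i]) := by
  have h3 := cs.length_mul_simple (π l) i
  have h4 := hl.eq
  change ℓ _ = _
  rw [cs.wordProd_append, cs.wordProd_singleton, List.length_append, List.length_singleton]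
  omega

theorem exists_reduced_sublist (l : List B) :
    ∃ l' : List B, l'.Sublist l ∧ cs.IsReduced l' ∧ π l' = π l := by
  induction l using List.reverseRecOn with
  | nil => exact ⟨[], by simp, by simp [CoxeterSystem.IsReduced], rfl⟩
  | append_singleton l i ih =>
    obtain ⟨m, hm, hred, hprod⟩ := ih
    by_cases h : ℓ (π m * s i) < ℓ (π m)
    · obtain ⟨j, hj, h1⟩ := exists_wordProd_eraseIdx (cs.isReflection_simple i) h
      refine ⟨m.eraseIdx j, (m.eraseIdx_sublist j).trans (hm.trans (List.sublist_append_left _ _)),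
        ?_, by rw [← h1, hprod, cs.wordProd_append, cs.wordProd_singleton]⟩
      have h2 := List.length_eraseIdx_add_one hj
      have h3 := cs.length_mul_simple (π m) i
      have h4 := hred.eq
      change ℓ _ = _
      rw [← h1]
      omega
    · refine ⟨m ++ [i], hm.append_right _, isReduced_append_singleton hred ?_, by
        rw [cs.wordProd_append, cs.wordProd_append, hprod]⟩
      have h3 := cs.length_mul_simple (π m) i
      omega


variable (cs)

/-- `x` is obtained from `y` by right multiplication by a reflection that decreases the length. -/
def BruhatStep (x y : W) : Prop := ∃ t, cs.IsReflection t ∧ x = y * t ∧ ℓ x < ℓ y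

variable {cs}

local infix:50 "≼" => Relation.ReflTransGen (BruhatStep cs)

theorem bruhatChain_mul_simple {x y : W} (h : x ≼ y) (i : B) :
    x * s i ≼ y * s i ∨ x * s i ≼ y := by
  induction h with
  | refl => exact .inl .refl
  | @tail y z hxy hyz ih =>
    rcases ih with ih | ih
    · obtain ⟨t, ht, rfl, hlt⟩ := hyz
      by_cases hts : t = s i
      · right
        subst hts
        simpa using ih
      · left
        refine ih.tail ⟨s i * t * s i, ?_, by simp [mul_assoc], ?_⟩
        · simpa using ht.conj (s i)
        · have hr : cs.IsReflection (s i * t * s i) := by simpa using ht.conj (s i)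
          have heq : z * t * s i = z * s i * (s i * t * s i) := by simp [mul_assoc]
          have hne : s i * t * s i ≠ s i := by
            intro h
            apply hts
            have := congrArg (fun x => s i * x * s i) h
            simpa [mul_assoc] using this
          rw [heq, length_mul_lt_iff hr, signCocycle_mul, signCocycle_simple, if_neg hne, zero_add]
          rw [length_mul_lt_iff ht] at hlt
          simpa [mul_assoc] using hlt
    · exact .inr (ih.tail hyz)

theorem bruhatStep_mul_simple {y : W} {i : B} (h : ℓ y < ℓ (y * s i)) :
    BruhatStep cs y (y * s i) :=
  ⟨s i, cs.isReflection_simple i, by simp, h⟩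

theorem exists_sublist_of_bruhatChain {x y : W} (h : x ≼ y) (l : List B) (hl : π l = y) :
    ∃ l' : List B, l'.Sublist l ∧ π l' = x := by
  induction h using Relation.ReflTransGen.head_induction_on with
  | refl => exact ⟨l, List.Sublist.refl l, hl⟩
  | head hstep _ ih =>
    obtain ⟨m, hm, rfl⟩ := ih
    obtain ⟨t, ht, rfl, hlt⟩ := hstep
    obtain ⟨j, _, hj⟩ := exists_wordProd_eraseIdx ht hlt
    exact ⟨m.eraseIdx j, (m.eraseIdx_sublist j).trans hm, hj.symm⟩

theorem bruhatChain_of_sublist {l l' : List B} (hl : cs.IsReduced l) (h : l'.Sublist l) :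
    π l' ≼ π l := by
  induction l using List.reverseRecOn generalizing l' with
  | nil => rw [List.sublist_nil.mp h]
  | append_singleton l i ih =>
    have hl1 : cs.IsReduced l := by
      have := hl.take l.length
      rwa [List.take_left] at this
    have hlt : ℓ (π l) < ℓ (π l * s i) := by
      have h1 := hl.eq
      have h2 := hl1.eq
      rw [cs.wordProd_append, cs.wordProd_singleton, List.length_append, List.length_singleton] at h1
      omega
    have hup := bruhatStep_mul_simple hlt
    obtain ⟨l₁, l₂, rfl, h1, h2⟩ := List.sublist_append_iff.mp h
    rw [cs.wordProd_append, cs.wordProd_append, cs.wordProd_singleton]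
    rcases List.sublist_singleton.mp h2 with rfl | rfl
    · simpa using (ih hl1 h1).tail hup
    · rw [cs.wordProd_singleton]
      rcases bruhatChain_mul_simple (ih hl1 h1) i with h3 | h3
      · exact h3
      · exact h3.tail hup

theorem bruhatLE_iff_bruhatChain {x y : W} : bruhatLE cs x y ↔ x ≼ y := by
  constructor
  · intro h
    obtain ⟨l, hl, rfl⟩ := cs.exists_isReduced y
    obtain ⟨l', hl', rfl⟩ := h l hl rfl
    exact bruhatChain_of_sublist hl hl'
  · intro h l _ hl
    exact exists_sublist_of_bruhatChain h l hl

theorem bruhatLE_refl (x : W) : bruhatLE cs x x :=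
  bruhatLE_iff_bruhatChain.mpr .refl

theorem bruhatLE.trans {x y z : W} (h₁ : bruhatLE cs x y) (h₂ : bruhatLE cs y z) :
    bruhatLE cs x z := by
  rw [bruhatLE_iff_bruhatChain] at *
  exact h₁.trans h₂

theorem bruhatLE.eq_or_length_lt {x y : W} (h : bruhatLE cs x y) : x = y ∨ ℓ x < ℓ y := by
  rw [bruhatLE_iff_bruhatChain] at h
  induction h with
  | refl => exact .inl rfl
  | tail _ hyz ih =>
    obtain ⟨t, ht, rfl, hlt⟩ := hyz
    rcases ih with rfl | ih
    · exact .inr hlt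
    · exact .inr (ih.trans hlt)

theorem bruhatLE.length_le {x y : W} (h : bruhatLE cs x y) : ℓ x ≤ ℓ y := by
  rcases h.eq_or_length_lt with rfl | h
  · exact le_rfl
  · exact h.le

theorem bruhatLE.exists_reflection {x y : W} (h : bruhatLE cs x y) (hl : ℓ y = ℓ x + 1) :
    ∃ t, cs.IsReflection t ∧ x = y * t := by
  have h' := bruhatLE_iff_bruhatChain.mp h
  rcases Relation.ReflTransGen.cases_tail h' with rfl | ⟨z, hxz, t, ht, rfl, hlt⟩
  · omega
  · rcases (bruhatLE_iff_bruhatChain.mpr hxz).eq_or_length_lt with rfl | h1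
    · exact ⟨t, ht, rfl⟩
    · omega

theorem bruhatLE.inv {x y : W} (h : bruhatLE cs x y) : bruhatLE cs x⁻¹ y⁻¹ := by
  intro l hl hy
  obtain ⟨l', hl', rfl⟩ := h l.reverse hl.reverse (by rw [cs.wordProd_reverse, hy, inv_inv])
  exact ⟨l'.reverse, by simpa using hl'.reverse, by simp⟩

theorem finite_setOf_bruhatLE (y : W) : {x | bruhatLE cs x y}.Finite := by
  obtain ⟨l, hl, rfl⟩ := cs.exists_isReduced y
  refine ((l.sublists.map cs.wordProd).finite_toSet).subset ?_
  intro x hx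
  obtain ⟨l', hl', rfl⟩ := hx l hl rfl
  simpa using ⟨l', hl', rfl⟩

theorem bruhatLE_mul_simple_of_gt {y : W} {i : B} (h : ℓ y < ℓ (y * s i)) :
    bruhatLE cs y (y * s i) :=
  bruhatLE_iff_bruhatChain.mpr (.single (bruhatStep_mul_simple h))

theorem bruhatLE_mul_simple_of_lt {y : W} {i : B} (h : ℓ (y * s i) < ℓ y) :
    bruhatLE cs (y * s i) y := by
  simpa using bruhatLE_mul_simple_of_gt (cs := cs) (y := y * s i) (i := i) (by simpa using h)

theorem bruhatLE.mul_simple_mul_simple {x y : W} {i : B} (h : bruhatLE cs x y)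
    (hy : ℓ y < ℓ (y * s i)) : bruhatLE cs (x * s i) (y * s i) := by
  have hup := bruhatLE_mul_simple_of_gt hy
  rw [bruhatLE_iff_bruhatChain] at *
  exact (bruhatChain_mul_simple h i).elim id fun h => h.trans hup

theorem bruhatLE.mul_simple_left {x y : W} {i : B} (h : bruhatLE cs x y)
    (hy : ℓ (y * s i) < ℓ y) : bruhatLE cs (x * s i) y := by
  have hdown := bruhatLE_mul_simple_of_lt hy
  rw [bruhatLE_iff_bruhatChain] at *
  exact (bruhatChain_mul_simple h i).elim (fun h => h.trans hdown) id

theorem bruhatLE.le_mul_simple_or {x y : W} {i : B} (h : bruhatLE cs x y)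
    (hy : ℓ (y * s i) < ℓ y) :
    bruhatLE cs x (y * s i) ∨ bruhatLE cs (x * s i) (y * s i) := by
  obtain ⟨l, hl, hprod⟩ := cs.exists_isReduced (y * s i)
  have hy' : y = π (l ++ [i]) := by
    rw [cs.wordProd_append, cs.wordProd_singleton, ← hprod, cs.simple_mul_simple_cancel_right]
  have hred : cs.IsReduced (l ++ [i]) :=
    isReduced_append_singleton hl (by rw [← hprod]; simpa using hy)
  obtain ⟨l', hl', rfl⟩ := h _ hred hy'.symm
  obtain ⟨l₁, l₂, rfl, h1, h2⟩ := List.sublist_append_iff.mp hl'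
  have h3 : bruhatLE cs (π l₁) (y * s i) := by
    rw [hprod, bruhatLE_iff_bruhatChain]
    exact bruhatChain_of_sublist hl h1
  rcases List.sublist_singleton.mp h2 with rfl | rfl
  · left; simpa using h3
  · right; simpa [cs.wordProd_append] using h3

theorem bruhatLE.le_mul_simple {x y : W} {i : B} (h : bruhatLE cs x y)
    (hy : ℓ (y * s i) < ℓ y) (hx : ℓ x < ℓ (x * s i)) : bruhatLE cs x (y * s i) :=
  (h.le_mul_simple_or hy).elim id fun h => (bruhatLE_mul_simple_of_gt hx).trans h

theorem bruhatLE.mul_simple_le_mul_simple {x y : W} {i : B} (h : bruhatLE cs x y)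
    (hy : ℓ (y * s i) < ℓ y) (hx : ℓ (x * s i) < ℓ x) : bruhatLE cs (x * s i) (y * s i) :=
  (h.le_mul_simple_or hy).elim (fun h => (bruhatLE_mul_simple_of_lt hx).trans h) id

theorem length_inv_mul_simple (x : W) (i : B) : ℓ (x⁻¹ * s i) = ℓ (s i * x) := by
  rw [← cs.length_inv]; simp

theorem bruhatLE.simple_mul_simple_mul {x y : W} {i : B} (h : bruhatLE cs x y)
    (hy : ℓ y < ℓ (s i * y)) : bruhatLE cs (s i * x) (s i * y) := by
  simpa using (h.inv.mul_simple_mul_simple (i := i)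
    (by simpa [length_inv_mul_simple] using hy)).inv

theorem bruhatLE.simple_mul_left {x y : W} {i : B} (h : bruhatLE cs x y)
    (hy : ℓ (s i * y) < ℓ y) : bruhatLE cs (s i * x) y := by
  simpa using (h.inv.mul_simple_left (i := i)
    (by simpa [length_inv_mul_simple] using hy)).inv

theorem bruhatLE.le_simple_mul {x y : W} {i : B} (h : bruhatLE cs x y)
    (hy : ℓ (s i * y) < ℓ y) (hx : ℓ x < ℓ (s i * x)) : bruhatLE cs x (s i * y) := by
  simpa using (h.inv.le_mul_simple (i := i) (by simpa [length_inv_mul_simple] using hy)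
    (by simpa [length_inv_mul_simple] using hx)).inv

theorem bruhatLE.simple_mul_le_simple_mul {x y : W} {i : B} (h : bruhatLE cs x y)
    (hy : ℓ (s i * y) < ℓ y) (hx : ℓ (s i * x) < ℓ x) : bruhatLE cs (s i * x) (s i * y) := by
  simpa using (h.inv.mul_simple_le_mul_simple (i := i)
    (by simpa [length_inv_mul_simple] using hy)
    (by simpa [length_inv_mul_simple] using hx)).inv

variable (cs) in
/-- `θ` is an involutive automorphism of the Coxeter system. -/
def IsDiagramInvolution (θ : W ≃* W) : Prop :=
  Function.Involutive θ ∧ ∀ i : B, ∃ j : B, θ (s i) = s j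

variable {θ : W ≃* W}

theorem IsDiagramInvolution.length_apply (hθ : IsDiagramInvolution cs θ) (x : W) :
    ℓ (θ x) = ℓ x := by
  have key : ∀ x, ℓ (θ x) ≤ ℓ x := by
    intro x
    obtain ⟨l, hl, rfl⟩ := cs.exists_isReduced x
    choose f hf using hθ.2
    have : θ (π l) = π (l.map f) := by
      rw [CoxeterSystem.wordProd, map_list_prod, CoxeterSystem.wordProd, List.map_map,
        List.map_map]
      congr 1
      exact List.map_congr_left fun i _ => hf i
    rw [this, hl.eq]
    simpa using cs.length_wordProd_le (l.map f)
  refine le_antisymm (key x) ?_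
  simpa only [hθ.1 x] using key (θ x)

theorem IsDiagramInvolution.isReflection (hθ : IsDiagramInvolution cs θ) {t : W}
    (ht : cs.IsReflection t) : cs.IsReflection (θ t) := by
  obtain ⟨w, i, rfl⟩ := ht
  obtain ⟨j, hj⟩ := hθ.2 i
  exact ⟨θ w, j, by simp [hj]⟩

theorem IsDiagramInvolution.signCocycle_apply (hθ : IsDiagramInvolution cs θ) {t : W}
    (ht : cs.IsReflection t) (x : W) :
    signCocycle cs (θ x) (θ t) = signCocycle cs x t := by
  have h := length_mul_lt_iff (w := x) ht
  have h' := length_mul_lt_iff (w := θ x) (hθ.isReflection ht)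
  rw [← map_mul, hθ.length_apply, hθ.length_apply, h] at h'
  clear h
  generalize signCocycle cs x t = a at *
  generalize signCocycle cs (θ x) (θ t) = b at *
  revert a b; decide

theorem IsDiagramInvolution.map_inv (hθ : IsDiagramInvolution cs θ) {w : W}
    (hw : w ∈ twistedIdentities θ) : θ w = w⁻¹ := by
  obtain ⟨v, rfl⟩ := hw
  simp [hθ.1 v]

theorem IsDiagramInvolution.length_map_simple_mul (hθ : IsDiagramInvolution cs θ) {w : W}
    (hw : w ∈ twistedIdentities θ) (i : B) : ℓ (θ (s i) * w) = ℓ (w * s i) := by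
  rw [← hθ.length_apply, map_mul, hθ.1, hθ.map_inv hw, ← cs.length_inv]
  simp

variable (cs) in
theorem conj_mem_twistedIdentities {w : W}
    (hw : w ∈ twistedIdentities θ) (i : B) : θ (s i) * w * s i ∈ twistedIdentities θ := by
  obtain ⟨v, rfl⟩ := hw
  exact ⟨v * s i, by simp [mul_assoc]⟩

theorem IsDiagramInvolution.not_commute_of_descent (hθ : IsDiagramInvolution cs θ) {w : W}
    (hw : w ∈ twistedIdentities θ) {i : B} (hi : ℓ (w * s i) < ℓ w) :
    θ (s i) * w ≠ w * s i := by
  intro h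
  rw [length_mul_lt_iff (cs.isReflection_simple i)] at hi
  obtain ⟨v, rfl⟩ := hw
  have hr : cs.IsReflection (v * s i * v⁻¹) := (cs.isReflection_simple i).conj v
  have hfix : θ (v * s i * v⁻¹) = v * s i * v⁻¹ := by
    have := congrArg (fun x => θ v * x * v⁻¹) h
    simpa [mul_assoc] using this
  rw [signCocycle_mul] at hi
  have h2 := hθ.signCocycle_apply hr v⁻¹
  rw [hfix, signCocycle_inv] at h2
  rw [h2, CharTwo.add_self_eq_zero] at hi
  exact absurd hi (by decide)

theorem IsDiagramInvolution.length_conj_of_descent (hθ : IsDiagramInvolution cs θ) {w : W}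
    (hw : w ∈ twistedIdentities θ) {i : B} (hi : ℓ (w * s i) < ℓ w) :
    ℓ (θ (s i) * w * s i) + 2 = ℓ w := by
  have h1 := hθ.not_commute_of_descent hw hi
  have h2 := hθ.length_map_simple_mul hw i
  obtain ⟨j, hj⟩ := hθ.2 i
  rw [hj] at h1 h2 ⊢
  exact length_simple_mul_mul_simple_of_lt h1 hi (by omega)

theorem IsDiagramInvolution.length_conj_of_ascent (hθ : IsDiagramInvolution cs θ) {w : W}
    (hw : w ∈ twistedIdentities θ) {i : B} (hi : ℓ w < ℓ (w * s i))
    (hne : θ (s i) * w ≠ w * s i) :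
    ℓ (θ (s i) * w * s i) = ℓ w + 2 := by
  have h2 := hθ.length_map_simple_mul hw i
  obtain ⟨j, hj⟩ := hθ.2 i
  rw [hj] at hne h2 ⊢
  exact length_simple_mul_mul_simple_of_gt hne hi (by omega)

theorem IsDiagramInvolution.conj_conj (hθ : IsDiagramInvolution cs θ) (w : W) (i : B) :
    θ (s i) * (θ (s i) * w * s i) * s i = w := by
  obtain ⟨j, hj⟩ := hθ.2 i
  simp [hj, mul_assoc]

theorem IsDiagramInvolution.length_twistAct_le (hθ : IsDiagramInvolution cs θ) (w : W) (i : B) :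
    ℓ (twistAct cs θ w i) ≤ ℓ w + 2 := by
  unfold twistAct
  obtain ⟨j, hj⟩ := hθ.2 i
  rw [hj]
  have h1 := cs.length_mul_simple w i
  have h2 := cs.length_mul_simple (s j * w) i
  have h3 := cs.length_simple_mul w j
  split_ifs <;> omega

theorem IsDiagramInvolution.length_twistProd_le (hθ : IsDiagramInvolution cs θ) (l : List B) :
    ℓ (twistProd cs θ l) ≤ 2 * l.length := by
  induction l using List.reverseRecOn with
  | nil => simp [twistProd]
  | append_singleton l i ih =>
    have h := hθ.length_twistAct_le (twistProd cs θ l) i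
    simp only [twistProd, List.foldl_append, List.foldl_cons, List.foldl_nil,
      List.length_append, List.length_singleton] at *
    omega

theorem IsDiagramInvolution.exists_twistProd_eq (hθ : IsDiagramInvolution cs θ) {w : W}
    (hw : w ∈ twistedIdentities θ) : ∃ l : List B, 2 * l.length = ℓ w ∧ twistProd cs θ l = w := by
  induction hn : ℓ w using Nat.strong_induction_on generalizing w with
  | h n ih =>
    subst hn
    by_cases h1 : w = 1
    · exact ⟨[], by simp [h1], by simp [twistProd, h1]⟩
    · obtain ⟨i, hi⟩ := cs.exists_rightDescent_of_ne_one h1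
      have hlen := hθ.length_conj_of_descent hw hi
      obtain ⟨l, hl, hprod⟩ := ih _ (by omega) (conj_mem_twistedIdentities cs hw i) rfl
      refine ⟨l ++ [i], by simp; omega, ?_⟩
      simp only [twistProd, List.foldl_append, List.foldl_cons, List.foldl_nil] at *
      rw [hprod, twistAct, hθ.conj_conj, if_neg]
      intro h
      rw [← h] at hlen
      omega

/-- On twisted identities the rank is half the Coxeter length. -/
theorem IsDiagramInvolution.two_mul_twistRank (hθ : IsDiagramInvolution cs θ) {w : W}
    (hw : w ∈ twistedIdentities θ) : 2 * twistRank cs θ w = ℓ w := by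
  obtain ⟨l, hl, hprod⟩ := hθ.exists_twistProd_eq hw
  have hmem : l.length ∈ {k | ∃ l : List B, l.length = k ∧ twistProd cs θ l = w} :=
    ⟨l, rfl, hprod⟩
  have h1 : twistRank cs θ w ≤ l.length := Nat.sInf_le hmem
  obtain ⟨l', hl', hprod'⟩ := Nat.sInf_mem ⟨_, hmem⟩
  have h2 := hθ.length_twistProd_le l'
  rw [hprod', hl'] at h2
  change ℓ w ≤ 2 * twistRank cs θ w at h2
  omega


variable (cs) in
/-- `x` lies in the parabolic subgroup generated by `s i` and `s j`. -/
def InDihedral (i j : B) (x : W) : Prop :=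
  ∃ l : List B, (∀ k ∈ l, k = i ∨ k = j) ∧ cs.IsReduced l ∧ π l = x

theorem inDihedral_wordProd {i j : B} {l : List B} (hl : ∀ k ∈ l, k = i ∨ k = j) :
    InDihedral cs i j (π l) := by
  obtain ⟨l', hsub, hred, hprod⟩ := exists_reduced_sublist (cs := cs) l
  exact ⟨l', fun k hk => hl k (hsub.subset hk), hred, hprod⟩

theorem InDihedral.mul {i j : B} {x y : W} (hx : InDihedral cs i j x)
    (hy : InDihedral cs i j y) : InDihedral cs i j (x * y) := by
  obtain ⟨l, hl, -, rfl⟩ := hx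
  obtain ⟨m, hm, -, rfl⟩ := hy
  rw [← cs.wordProd_append]
  exact inDihedral_wordProd fun k hk => (List.mem_append.mp hk).elim (hl k) (hm k)

theorem InDihedral.inv {i j : B} {x : W} (hx : InDihedral cs i j x) :
    InDihedral cs i j x⁻¹ := by
  obtain ⟨l, hl, -, rfl⟩ := hx
  rw [← cs.wordProd_reverse]
  exact inDihedral_wordProd fun k hk => hl k (List.mem_reverse.mp hk)

theorem inDihedral_simple {i j k : B} (hk : k = i ∨ k = j) : InDihedral cs i j (s k) := by
  rw [← cs.wordProd_singleton]
  exact inDihedral_wordProd (by simpa using hk)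

theorem InDihedral.of_signCocycle {i j : B} {x r : W} (hx : InDihedral cs i j x)
    (h : signCocycle cs x r = 1) : InDihedral cs i j r := by
  obtain ⟨l, hl, -, rfl⟩ := hx
  have hmem := mem_rightInvSeq_of_signCocycle_ne_zero cs l r (by rw [h]; decide)
  clear h
  induction l with
  | nil => simp at hmem
  | cons a l ih =>
    have hl' : ∀ k ∈ l, k = i ∨ k = j := fun k hk => hl k (List.mem_cons_of_mem a hk)
    rw [CoxeterSystem.rightInvSeq, List.mem_cons] at hmem
    rcases hmem with rfl | hmem
    · exact ((inDihedral_wordProd hl').inv.mul (inDihedral_simple (hl a (by simp)))).mul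
        (inDihedral_wordProd hl')
    · exact ih hl' hmem

theorem InDihedral.eq_simple {i j : B} {x : W} (hx : InDihedral cs i j x) (h : ℓ x = 1) :
    x = s i ∨ x = s j := by
  obtain ⟨l, hl, hred, rfl⟩ := hx
  rw [hred.eq, List.length_eq_one_iff] at h
  obtain ⟨a, rfl⟩ := h
  simpa using (hl a (by simp)).imp (congrArg cs.simple) (congrArg cs.simple)

theorem eq_alternatingWord {i j : B} {l : List B} {a : B} (hl : ∀ k ∈ l ++ [a], k = i ∨ k = j)
    (hred : cs.IsReduced (l ++ [a])) :
    (a = i ∧ l ++ [a] = CoxeterSystem.alternatingWord j i (l.length + 1)) ∨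
      (a = j ∧ l ++ [a] = CoxeterSystem.alternatingWord i j (l.length + 1)) := by
  induction l using List.reverseRecOn generalizing a with
  | nil =>
    rcases hl a (by simp) with rfl | rfl <;> simp [CoxeterSystem.alternatingWord]
  | append_singleton l b ih =>
    have hred' : cs.IsReduced (l ++ [b]) := by
      simpa only [List.length_append, List.length_singleton, List.take_left'] using
        hred.take (l ++ [b]).length
    have hab : a ≠ b := by
      rintro rfl
      have h1 := hred.eq
      have h2 := cs.length_wordProd_le l
      simp only [CoxeterSystem.wordProd_append, CoxeterSystem.wordProd_singleton, mul_assoc,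
        cs.simple_mul_simple_self, mul_one, List.length_append, List.length_singleton] at h1
      omega
    have hl' : ∀ k ∈ l ++ [b], k = i ∨ k = j := fun k hk => hl k (List.mem_append_left _ hk)
    have ha := hl a (by simp)
    rcases ih hl' hred' with ⟨rfl, h⟩ | ⟨rfl, h⟩
    · obtain rfl := ha.resolve_left hab
      right
      rw [h]
      simp [CoxeterSystem.alternatingWord]
    · obtain rfl := ha.resolve_right hab
      left
      rw [h]
      simp [CoxeterSystem.alternatingWord]

theorem InDihedral.eq_wordProd_alternatingWord {i j : B} (hij : s i ≠ s j) {x : W}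
    (hx : InDihedral cs i j x) (h : ℓ (x * s j) < ℓ x) :
    x = π (CoxeterSystem.alternatingWord i j (ℓ x)) := by
  obtain ⟨l, hl, hred, hprod⟩ := hx.mul (inDihedral_simple (.inr rfl))
  have hx' : x = π (l ++ [j]) := by simp [cs.wordProd_append, hprod]
  have hred' : cs.IsReduced (l ++ [j]) :=
    isReduced_append_singleton hred (by rw [hprod]; simpa using h)
  have hlen : ℓ x = l.length + 1 := by rw [hx', hred'.eq]; simp
  have hl' : ∀ k ∈ l ++ [j], k = i ∨ k = j := by
    intro k hk
    rcases List.mem_append.mp hk with hk | hk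
    · exact hl k hk
    · exact .inr (by simpa using hk)
  rcases eq_alternatingWord hl' hred' with ⟨h1, -⟩ | ⟨-, h2⟩
  · exact absurd (congrArg cs.simple h1.symm) hij
  · rw [hlen, ← h2, hx']

/-- The longest element of a dihedral parabolic subgroup with `m(s,s')` not odd is a power of
the rotation `s s'`. -/
theorem InDihedral.eq_pow {i j : B} (hij : s i ≠ s j) {b : W} (hb : InDihedral cs i j b)
    (hi : ℓ (b * s i) < ℓ b) (hj : ℓ (b * s j) < ℓ b)
    (hord : Even (orderOf (s i * s j)) ∨ orderOf (s i * s j) = 0) :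
    ∃ k : ℕ, b = (s i * s j) ^ k ∧ b = (s j * s i) ^ k := by
  have h1 := hb.eq_wordProd_alternatingWord hij hj
  have hb' : InDihedral cs j i b := by
    obtain ⟨l, hl, h⟩ := hb
    exact ⟨l, fun k hk => (hl k hk).symm, h⟩
  have h2 := hb'.eq_wordProd_alternatingWord hij.symm hi
  rw [cs.prod_alternatingWord_eq_mul_pow] at h1 h2
  by_cases he : Even (ℓ b)
  · exact ⟨ℓ b / 2, by simpa [he] using h1, by simpa [he] using h2⟩
  · exfalso
    rw [if_neg he] at h1 h2
    have hinv : s j * s i = (s i * s j)⁻¹ := by simp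
    have h3 : (s i * s j) ^ (2 * (ℓ b / 2) + 1) = 1 := by
      have h4 := h1.symm.trans h2
      rw [hinv, inv_pow, eq_mul_inv_iff_mul_eq, mul_assoc, ← pow_add] at h4
      rw [pow_succ', mul_assoc, two_mul, h4]
      simp
    have h5 := orderOf_dvd_of_pow_eq_one h3
    rcases hord with hord | hord
    · have h6 := (even_iff_two_dvd.mp hord).trans h5
      omega
    · rw [hord] at h5
      simp at h5

/-- If `x` is minimal in its coset of a dihedral parabolic subgroup, lengths add up. -/
theorem InDihedral.length_mul {i j : B} {x d : W}
    (hx : ∀ r, InDihedral cs i j r → ℓ x ≤ ℓ (x * r)) (hd : InDihedral cs i j d) :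
    ℓ (x * d) = ℓ x + ℓ d := by
  obtain ⟨l, hl, hred, rfl⟩ := hd
  induction l using List.reverseRecOn with
  | nil => simp
  | append_singleton l a ih =>
    have hred' : cs.IsReduced l := by simpa using hred.take l.length
    have hl' : ∀ k ∈ l, k = i ∨ k = j := fun k hk => hl k (List.mem_append_left _ hk)
    have ha := cs.isReflection_simple a
    have h1 : signCocycle cs (π l) (s a) = 0 := by
      rw [← not_length_mul_lt_iff ha, ← cs.wordProd_singleton, ← cs.wordProd_append, hred.eq,
        hred'.eq]
      simp
    have h2 : signCocycle cs x (π l * s a * (π l)⁻¹) = 0 := by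
      rw [← not_length_mul_lt_iff (ha.conj _), not_lt]
      exact hx _ (((inDihedral_wordProd hl').mul (inDihedral_simple (hl a (by simp)))).mul
        (inDihedral_wordProd hl').inv)
    have h3 : signCocycle cs (x * π l) (s a) = 0 := by
      rw [signCocycle_mul, h1, h2, add_zero]
    rw [← not_length_mul_lt_iff ha] at h3
    have h4 := cs.length_mul_simple (x * π l) a
    rw [ih hl' hred', hred'.eq] at h3 h4
    rw [hred.eq, cs.wordProd_append, cs.wordProd_singleton, ← mul_assoc, List.length_append,
      List.length_singleton]
    omega

theorem isReflection_mul_pow {t c p : W} (ht : cs.IsReflection t) (htc : t * c = c⁻¹ * t)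
    (hp : t * c = p * t * p⁻¹) (k : ℕ) : cs.IsReflection (t * c ^ k) := by
  have h : ∀ m : ℕ, t * c ^ m = (c ^ m)⁻¹ * t := by
    intro m
    induction m with
    | zero => simp
    | succ m ih => rw [pow_succ, ← mul_assoc, ih, mul_assoc, htc, ← pow_succ, pow_succ']; group
  obtain ⟨m, rfl | rfl⟩ := Nat.even_or_odd' k
  · have := ht.conj (c ^ m)⁻¹
    rwa [← h, inv_inv, mul_assoc, ← pow_add, ← two_mul] at this
  · have := (ht.conj p).conj (c ^ m)⁻¹
    rwa [← hp, ← mul_assoc, ← h, inv_inv, mul_assoc, mul_assoc, ← pow_succ', ← pow_add,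
      ← add_assoc, ← two_mul] at this

/-- Let `t = x * b` with `x` minimal in its coset of the dihedral subgroup of `s i, s j` and `b`
the longest element of that subgroup. If the reflection `t ≠ s i` has `s i` as a descent, then
`s i` shortens `x` on the left. -/
theorem length_simple_mul_lt_of_dihedral {t x b : W} {i j : B} (ht : cs.IsReflection t)
    (hti : t ≠ s i) (hb : InDihedral cs i j b) (htx : t = x * b) {k : ℕ}
    (hbc : b = (s i * s j) ^ k) (hbc' : b = (s j * s i) ^ k)
    (hmin : ∀ r, InDihedral cs i j r → ℓ x ≤ ℓ (x * r))
    (hdesc : ℓ (t * s i) < ℓ t)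
    (hswap : x⁻¹ * s i * x = s j → x⁻¹ * s j * x = s i) :
    ℓ (s i * x) < ℓ x := by
  by_contra hcon
  have hi := cs.isReflection_simple i
  have hbinv : b⁻¹ = b := by
    rw [hbc, ← inv_pow, mul_inv_rev, cs.inv_simple, cs.inv_simple, ← hbc', hbc]
  have hbb : b * b = 1 := inv_eq_iff_mul_eq_one.mp hbinv
  have hconj : ∀ p c : W, p * c = c⁻¹ * p → ∀ m : ℕ, p * c ^ m = (c ^ m)⁻¹ * p := by
    intro p c h m
    have : SemiconjBy p c c⁻¹ := h
    simpa using (this.pow_right m).eq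
  have hcinv : (s i * s j)⁻¹ = s j * s i := by simp
  have hbi : s i * b = b * s i := by
    rw [hbc, hconj _ _ (by simp [mul_assoc]), ← hbc, hbinv]
  have hbj : s j * b = b * s j := by
    rw [hbc', hconj _ _ (by simp [mul_assoc]), ← hbc', hbinv]
  have hsc : signCocycle cs t (s i) = 1 := (length_mul_lt_iff hi).mp hdesc
  have hx0 : ∀ r, InDihedral cs i j r → cs.IsReflection r → signCocycle cs x r = 0 := by
    intro r hr hr'
    rw [← not_length_mul_lt_iff hr', not_lt]
    exact hmin r hr
  have hbsc : signCocycle cs b (s i) = 1 := by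
    have h := signCocycle_mul cs x b (s i)
    rw [← htx, hsc, hx0 _ ((hb.mul (inDihedral_simple (.inl rfl))).mul hb.inv) (hi.conj b),
      add_zero] at h
    exact h.symm
  have hb1 : b ≠ 1 := by
    rintro rfl
    rw [signCocycle_one] at hbsc
    exact absurd hbsc (by decide)
  have htinv : t⁻¹ = t := ht.inv
  have htt : t * t = 1 := ht.mul_self
  have hr : signCocycle cs b (x⁻¹ * s i * x) = 1 := by
    have h := signCocycle_mul cs b⁻¹ x⁻¹ (s i)
    rw [← mul_inv_rev, ← htx, htinv, hsc, hbinv, inv_inv] at h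
    have h0 : signCocycle cs x⁻¹ (s i) = 0 := by
      rw [← not_length_mul_lt_iff hi, length_inv_mul_simple, cs.length_inv]
      exact hcon
    rw [h0, zero_add] at h
    exact h.symm
  have hrD := hb.of_signCocycle hr
  have hrlen : ℓ (x⁻¹ * s i * x) = 1 := by
    have h1 := InDihedral.length_mul hmin hrD
    have h2 := cs.length_simple_mul x i
    have h3 : x * (x⁻¹ * s i * x) = s i * x := by group
    rw [h3] at h1
    omega
  have htconj : ∀ a, t⁻¹ * a * t = b⁻¹ * (x⁻¹ * a * x) * b := by
    intro a
    rw [htx]; group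
  rcases hrD.eq_simple hrlen with h | h
  · have h1 : t⁻¹ * s i * t = s i := by
      rw [htconj, h, mul_assoc, hbi, inv_mul_cancel_left]
    have h2 : t * s i = s i * t := by
      rw [mul_assoc, inv_mul_eq_iff_eq_mul] at h1
      exact h1.symm
    rw [signCocycle_of_commute ht hti.symm h2] at hsc
    exact absurd hsc (by decide)
  · have h1 : t⁻¹ * s i * t = s j := by
      rw [htconj, h, mul_assoc, hbj, inv_mul_cancel_left]
    have h2 : t⁻¹ * s j * t = s i := by
      rw [htconj, hswap h, mul_assoc, hbi, inv_mul_cancel_left]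
    have h1' : s i * t = t * s j := by rwa [mul_assoc, inv_mul_eq_iff_eq_mul] at h1
    have h2' : s j * t = t * s i := by rwa [mul_assoc, inv_mul_eq_iff_eq_mul] at h2
    have htc : t * (s i * s j) = (s i * s j)⁻¹ * t := by
      rw [hcinv, ← mul_assoc, ← h2', mul_assoc, ← h1', mul_assoc]
    have htb : t * b = b * t := by
      rw [hbc, hconj _ _ htc, ← hbc, hbinv]
    have hxt : x = t * b := by rw [htx, mul_assoc, hbb, mul_one]
    have hxrefl : cs.IsReflection x := by
      rw [hxt, hbc]
      refine isReflection_mul_pow ht htc (p := s j) ?_ k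
      rw [h2', cs.inv_simple, mul_assoc]
    have hxb : b = x * t := by rw [hxt, htb, mul_assoc, htt, mul_one]
    have hxne : x ≠ t := by
      rintro rfl
      exact hb1 (by rw [hxb, htt])
    have hcomm : t * x = x * t := by rw [hxt, mul_assoc, htb, ← mul_assoc]
    have h0 := signCocycle_of_commute ht hxne hcomm
    have hbxb : b * x * b⁻¹ = x := by
      rw [hxt, htb, hbinv, mul_assoc, mul_assoc, htb]
      rw [← mul_assoc b b, hbb, one_mul]
    have h3 := signCocycle_mul cs x b x
    rw [← htx, h0, hbxb, signCocycle_self hxrefl] at h3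
    have h4 : signCocycle cs b x = 1 := by
      generalize signCocycle cs b x = a at h3
      revert a; decide
    have h5 := hmin _ (hb.of_signCocycle h4).inv
    rw [mul_inv_cancel, cs.length_one] at h5
    have h6 := hxrefl.odd_length
    rw [Nat.le_zero.mp h5] at h6
    exact absurd h6 (by decide)

/-- Under the no-odd-flip property every `θ`-fixed reflection is conjugate, by a `θ`-fixed
element, to a `θ`-fixed simple reflection. -/
theorem IsDiagramInvolution.exists_conj_eq_simple (hθ : IsDiagramInvolution cs θ)
    (hNOF : NOF cs θ) {t : W} (ht : cs.IsReflection t) (hfix : θ t = t) :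
    ∃ g i, θ g = g ∧ g * t * g⁻¹ = s i := by
  induction hn : ℓ t using Nat.strong_induction_on generalizing t with
  | h n ih =>
    subst hn
    by_cases h1 : ℓ t = 1
    · obtain ⟨i, rfl⟩ := cs.length_eq_one_iff.mp h1
      exact ⟨1, i, by simp, by simp⟩
    have step : ∀ g, θ g = g → ℓ (g * t * g⁻¹) < ℓ t → ∃ g i, θ g = g ∧ g * t * g⁻¹ = s i := by
      intro g hg hlt
      obtain ⟨g', i, hg', hi⟩ := ih _ hlt (ht.conj g) (by simp [hg, hfix]) rfl
      exact ⟨g' * g, i, by simp [hg, hg'], by rw [← hi]; group⟩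
    have hsimple : ∀ i, t ≠ s i := by
      rintro i rfl
      exact h1 (cs.length_simple i)
    have ht1 : t ≠ 1 := by
      rintro rfl
      simpa using ht.odd_length
    obtain ⟨i, hi⟩ := cs.exists_rightDescent_of_ne_one ht1
    change ℓ (t * s i) < ℓ t at hi
    have hirefl := cs.isReflection_simple i
    have hleft : ℓ (s i * t) < ℓ t := by
      rw [← length_inv_mul_simple, ht.inv]
      exact hi
    obtain ⟨j, hj⟩ := hθ.2 i
    by_cases hij : s i = s j
    · rw [← hij] at hj
      refine step (s i) hj ?_
      have hne : s i * t ≠ t * s i := by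
        intro h
        have h2 := (length_mul_lt_iff hirefl).mp hi
        rw [signCocycle_of_commute ht (hsimple i).symm h.symm] at h2
        exact absurd h2 (by decide)
      have := length_simple_mul_mul_simple_of_lt hne hi hleft
      rw [cs.inv_simple]
      omega
    · have hj' : θ (s j) = s i := by rw [← hj, hθ.1]
      obtain ⟨y, hyD, hymin⟩ : ∃ y, InDihedral cs i j y ∧
          ∀ z, InDihedral cs i j z → ℓ (t * y) ≤ ℓ (t * z) := by
        have hne : {y | InDihedral cs i j y}.Nonempty := ⟨1, [], by simp,
          by simp [CoxeterSystem.IsReduced], by simp⟩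
        obtain ⟨y, hy, hmin⟩ := WellFounded.has_min
          (InvImage.wf (fun y => ℓ (t * y)) wellFounded_lt) _ hne
        exact ⟨y, hy, fun z hz => not_lt.mp (hmin z hz)⟩
      set x := t * y with hx
      have hb := hyD.inv
      set b := y⁻¹ with hbdef
      have htx : t = x * b := by rw [hx, hbdef]; group
      have hmin : ∀ r, InDihedral cs i j r → ℓ x ≤ ℓ (x * r) := by
        intro r hr
        rw [hx, mul_assoc]
        exact hymin _ (hyD.mul hr)
      have hdesc : ∀ a, (a = i ∨ a = j) → ℓ (t * s a) < ℓ t → ℓ (b * s a) < ℓ b := by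
        intro a ha h
        have harefl := cs.isReflection_simple a
        rw [length_mul_lt_iff harefl] at h ⊢
        have h0 : signCocycle cs x (b * s a * b⁻¹) = 0 := by
          rw [← not_length_mul_lt_iff (harefl.conj b), not_lt]
          exact hmin _ ((hb.mul (inDihedral_simple ha)).mul hb.inv)
        rw [htx, signCocycle_mul, h0, add_zero] at h
        exact h
      have hbi := hdesc i (.inl rfl) hi
      have htj : ℓ (t * s j) < ℓ t := by
        rw [← hj, ← hθ.length_apply, map_mul, hfix, hθ.1]
        exact hi
      have hbj := hdesc j (.inr rfl) htj
      have hord := hNOF i (by rw [hj]; exact Ne.symm hij)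
      rw [hj] at hord
      obtain ⟨k, hbc, hbc'⟩ := hb.eq_pow hij hbi hbj hord
      have hθb : θ b = b := by
        conv_lhs => rw [hbc]
        rw [map_pow, map_mul, hj, hj', hbc']
      have hθx : θ x = x := by
        have : x = t * b⁻¹ := by rw [htx]; group
        rw [this, map_mul, _root_.map_inv, hfix, hθb]
      refine step b hθb ?_
      have hlt := length_simple_mul_lt_of_dihedral ht (hsimple i) hb htx hbc hbc' hmin hi
        (by
          intro h
          have := congrArg θ h
          simpa [hθx, hj, hj'] using this)
      have hlen : ℓ t = ℓ x + ℓ b := by rw [htx]; exact InDihedral.length_mul hmin hb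
      have heq : b * t * b⁻¹ = (b * s i) * (s i * x) := by
        rw [htx]; simp [mul_assoc]
      rw [heq, hlen]
      have := cs.length_mul_le (b * s i) (s i * x)
      omega

theorem simple_mul_comm_of_length_conj {R : W} (hR : cs.IsReflection R) {k : B}
    (h : ℓ (s k * R * s k) = ℓ R) : s k * R = R * s k := by
  by_contra hne
  have h1 : ℓ (s k * R) = ℓ (R * s k) := by
    rw [← length_inv_mul_simple, hR.inv]
  rcases cs.length_mul_simple R k with h2 | h2
  · have := length_simple_mul_mul_simple_of_gt hne (by omega) (by omega)
    omega
  · have := length_simple_mul_mul_simple_of_lt hne (by omega) (by omega)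
    omega

/-- Under the no-odd-flip property, a simple reflection that strictly raises `y` by two also
raises by two every cover `z` of `y` of which it is not a descent. -/
theorem IsDiagramInvolution.not_commute_of_cover (hθ : IsDiagramInvolution cs θ)
    (hNOF : NOF cs θ) {y z : W} {i : B} (hy : y ∈ twistedIdentities θ)
    (hz : z ∈ twistedIdentities θ) (hyz : bruhatLE cs y z) (hlen : ℓ z = ℓ y + 2)
    (hyi : ℓ y < ℓ (y * s i)) (hzi : ℓ z < ℓ (z * s i))
    (hne : θ (s i) * y ≠ y * s i) : θ (s i) * z ≠ z * s i := by
  intro h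
  have hconj := hθ.length_conj_of_ascent hy hyi hne
  have hθy := hθ.map_inv hy
  obtain ⟨j, hj⟩ := hθ.2 i
  rw [hj] at h hne hconj
  have h1 := hyz.mul_simple_mul_simple hzi
  have h2 : s j * (z * s i) = z := by rw [← h, cs.simple_mul_simple_cancel_left]
  have h3 := h1.simple_mul_left (i := j) (by rw [h2]; exact hzi)
  rw [← mul_assoc] at h3
  have h4 := cs.length_mul_simple z i
  obtain ⟨t, ht, hyt⟩ := h3.exists_reflection (by omega)
  have hyz' : y = z * t * s i := by
    have h5 : y = s j * (s j * y * s i) * s i := by simp [mul_assoc]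
    rw [h5, hyt, ← mul_assoc, h2]
  suffices hst : s i * t = t * s i by
    apply hne
    rw [hyz', ← mul_assoc, ← mul_assoc, h, mul_assoc z, hst]
    simp [mul_assoc]
  obtain ⟨w, rfl⟩ := hz
  have hP : θ (w * s i * w⁻¹) = w * s i * w⁻¹ := by
    have := congrArg (fun x => θ w * x * w⁻¹) h
    simpa [mul_assoc, hj] using this
  have hR : θ (w * t * w⁻¹) = (w * s i * w⁻¹) * (w * t * w⁻¹) * (w * s i * w⁻¹)⁻¹ := by
    have h5 : θ t = (θ w⁻¹ * w) * (s i * t * s i) * (θ w⁻¹ * w)⁻¹ := by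
      rw [hyz'] at hθy
      have h6 : (θ w⁻¹ * w)⁻¹ * s j = s i * (θ w⁻¹ * w)⁻¹ := by
        rw [inv_mul_eq_iff_eq_mul, ← mul_assoc, eq_mul_inv_iff_mul_eq]
        exact h
      have h7 : θ (θ w⁻¹ * w) = (θ w⁻¹ * w)⁻¹ := by simp [hθ.1 w]
      rw [map_mul, map_mul, h7, hj] at hθy
      generalize θ w⁻¹ * w = z at *
      have h8 : θ t = z * (z⁻¹ * θ t * s j) * s j := by simp [mul_assoc]
      rw [h8, hθy]
      simp only [mul_inv_rev, cs.inv_simple, mul_assoc, h6, ht.inv]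
    rw [map_mul, map_mul, h5]
    simp [mul_assoc]
  obtain ⟨g, k, hg, hk⟩ := hθ.exists_conj_eq_simple hNOF ((cs.isReflection_simple i).conj w) hP
  have hcomm := simple_mul_comm_of_length_conj (R := g * (w * t * w⁻¹) * g⁻¹) (k := k)
    ((ht.conj w).conj g) (by
      rw [← hθ.length_apply (g * _ * g⁻¹), map_mul, map_mul, hR, _root_.map_inv, hg, ← hk]
      congr 1
      simp [mul_assoc])
  have h9 := congrArg (fun x => (g * w)⁻¹ * x * (g * w)) (hk ▸ hcomm)
  simpa [mul_assoc] using h9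

theorem IsDiagramInvolution.bruhatLE_conj_of_ascent (hθ : IsDiagramInvolution cs θ) {w : W}
    (hw : w ∈ twistedIdentities θ) {i : B} (hi : ℓ w < ℓ (w * s i))
    (hne : θ (s i) * w ≠ w * s i) : bruhatLE cs w (θ (s i) * w * s i) := by
  have h1 := hθ.length_conj_of_ascent hw hi hne
  have h2 := cs.length_mul_simple w i
  obtain ⟨j, hj⟩ := hθ.2 i
  rw [hj, mul_assoc] at h1 ⊢
  refine (bruhatLE_mul_simple_of_gt hi).trans ?_
  simpa using (bruhatLE_refl (cs := cs) (w * s i)).simple_mul_simple_mul (i := j)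
    (by omega) |>.simple_mul_left (i := j) (by simp; omega)

theorem IsDiagramInvolution.bruhatLE_conj_left (hθ : IsDiagramInvolution cs θ) {u v : W}
    (hv : v ∈ twistedIdentities θ) {i : B} (huv : bruhatLE cs u v) (hi : ℓ (v * s i) < ℓ v) :
    bruhatLE cs (θ (s i) * u * s i) v := by
  have h2 := hθ.length_map_simple_mul hv i
  obtain ⟨j, hj⟩ := hθ.2 i
  rw [hj] at h2 ⊢
  exact (huv.simple_mul_left (by omega)).mul_simple_left hi

theorem IsDiagramInvolution.bruhatLE_conj_right (hθ : IsDiagramInvolution cs θ) {u v : W}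
    (hu : u ∈ twistedIdentities θ) (hv : v ∈ twistedIdentities θ) {i : B}
    (huv : bruhatLE cs u v) (hvi : ℓ (v * s i) < ℓ v) (hui : ℓ u < ℓ (u * s i)) :
    bruhatLE cs u (θ (s i) * v * s i) := by
  have h1 := hθ.length_map_simple_mul hu i
  have h2 := hθ.length_conj_of_descent hv hvi
  have h3 := cs.length_mul_simple v i
  obtain ⟨j, hj⟩ := hθ.2 i
  rw [hj] at h1 h2 ⊢
  rw [mul_assoc] at h2 ⊢
  exact (huv.le_mul_simple hvi hui).le_simple_mul (by omega) (by omega)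

theorem IsDiagramInvolution.bruhatLE_conj_conj (hθ : IsDiagramInvolution cs θ) {u v : W}
    (hu : u ∈ twistedIdentities θ) (hv : v ∈ twistedIdentities θ) {i : B}
    (huv : bruhatLE cs u v) (hvi : ℓ (v * s i) < ℓ v) (hui : ℓ (u * s i) < ℓ u) :
    bruhatLE cs (θ (s i) * u * s i) (θ (s i) * v * s i) := by
  have h1 := hθ.length_conj_of_descent hu hui
  have h2 := hθ.length_conj_of_descent hv hvi
  have h3 := cs.length_mul_simple v i
  have h4 := cs.length_mul_simple u i
  obtain ⟨j, hj⟩ := hθ.2 i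
  rw [hj] at h1 h2 ⊢
  rw [mul_assoc] at h1 h2 ⊢
  rw [mul_assoc]
  exact (huv.mul_simple_le_mul_simple hvi hui).simple_mul_le_simple_mul (by omega) (by omega)

theorem IsDiagramInvolution.exists_descent_or_ascent (hθ : IsDiagramInvolution cs θ)
    (hNOF : NOF cs θ) {n : ℕ}
    (hcoatom : ∀ v ∈ twistedIdentities θ, ℓ v < n → ∀ u ∈ twistedIdentities θ,
      bruhatLE cs u v → u ≠ v →
      ∃ x ∈ twistedIdentities θ, bruhatLE cs u x ∧ bruhatLE cs x v ∧ ℓ x + 2 = ℓ v)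
    {a b : W} {i : B} (ha : a ∈ twistedIdentities θ) (hb : b ∈ twistedIdentities θ)
    (hab : bruhatLE cs a b) (hbn : ℓ b < n) (hai : ℓ a < ℓ (a * s i))
    (hne : θ (s i) * a ≠ a * s i) :
    (∃ c ∈ twistedIdentities θ, bruhatLE cs a c ∧ bruhatLE cs c b ∧ ℓ (c * s i) < ℓ c) ∨
      ℓ b < ℓ (b * s i) ∧ θ (s i) * b ≠ b * s i := by
  induction hm : ℓ b using Nat.strong_induction_on generalizing b with
  | h m ih =>
    subst hm
    by_cases h1 : a = b
    · exact .inr (h1 ▸ ⟨hai, hne⟩)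
    have h2 := cs.length_mul_simple b i
    by_cases h3 : ℓ (b * s i) < ℓ b
    · exact .inl ⟨b, hb, hab, bruhatLE_refl b, h3⟩
    obtain ⟨x, hx, hax, hxb, hlen⟩ := hcoatom b hb hbn a ha hab h1
    rcases ih _ (by omega) hx hax (by omega) rfl with ⟨c, hc, hac, hcx, hci⟩ | ⟨h4, h5⟩
    · exact .inl ⟨c, hc, hac, hcx.trans hxb, hci⟩
    · have h6 : ℓ b < ℓ (b * s i) := by omega
      exact .inr ⟨h6, hθ.not_commute_of_cover hNOF hx hb hxb hlen.symm h4 h6 h5⟩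

/-- Every nontrivial interval of twisted identities has a coatom of length two less than its
top element. -/
theorem IsDiagramInvolution.exists_coatom (hθ : IsDiagramInvolution cs θ) (hNOF : NOF cs θ)
    {u v : W} (hu : u ∈ twistedIdentities θ) (hv : v ∈ twistedIdentities θ)
    (huv : bruhatLE cs u v) (hne : u ≠ v) :
    ∃ x ∈ twistedIdentities θ, bruhatLE cs u x ∧ bruhatLE cs x v ∧ ℓ x + 2 = ℓ v := by
  induction hn : ℓ v using Nat.strong_induction_on generalizing u v with
  | h n ih =>
    subst hn
    have hv1 : v ≠ 1 := by
      rintro rfl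
      have := huv.eq_or_length_lt.resolve_left hne
      simp at this
    obtain ⟨i, hi⟩ := cs.exists_rightDescent_of_ne_one hv1
    change ℓ (v * s i) < ℓ v at hi
    have hv' := conj_mem_twistedIdentities cs hv i
    have hvlen := hθ.length_conj_of_descent hv hi
    have hvle := hθ.bruhatLE_conj_left hv (bruhatLE_refl v) hi
    have hul := cs.length_mul_simple u i
    by_cases hui : ℓ u < ℓ (u * s i)
    · exact ⟨_, hv', hθ.bruhatLE_conj_right hu hv huv hi hui, hvle, hvlen⟩
    have hui' : ℓ (u * s i) < ℓ u := by omega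
    have hulen := hθ.length_conj_of_descent hu hui'
    have hu' := conj_mem_twistedIdentities cs hu i
    have hule := hθ.bruhatLE_conj_conj hu hv huv hi hui'
    have hcc := hθ.conj_conj u i
    have hcv := hθ.conj_conj v i
    set a := θ (s i) * u * s i with ha
    set b := θ (s i) * v * s i with hb
    have hab : a ≠ b := by
      intro h
      rw [h] at hcc
      exact hne (hcc.symm.trans hcv)
    obtain ⟨y, hy, hay, hyb, hylen⟩ := ih _ (by omega) hu' hv' hule hab rfl
    have hai : ℓ a < ℓ (a * s i) := by
      have h1 := cs.length_mul_simple a i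
      obtain ⟨j, hj⟩ := hθ.2 i
      have h2 := cs.length_simple_mul (a * s i) j
      rw [← mul_assoc, ← hj, hcc] at h2
      omega
    have hane : θ (s i) * a ≠ a * s i := by
      intro h
      rw [h, cs.simple_mul_simple_cancel_right] at hcc
      rw [hcc] at hulen
      omega
    rcases hθ.exists_descent_or_ascent hNOF
      (fun v hv h u hu huv hne => ih _ h hu hv huv hne rfl) hu' hy hay (by omega) hai hane with
      ⟨c, hc, hac, hcy, hci⟩ | ⟨hyi, hyne⟩
    · refine ⟨b, hv', ?_, hvle, hvlen⟩
      have := hθ.bruhatLE_conj_left hc hac hci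
      rw [hcc] at this
      exact this.trans (hcy.trans hyb)
    · have hyup := hθ.length_conj_of_ascent hy hyi hyne
      have hxi : ℓ (θ (s i) * y * s i * s i) < ℓ (θ (s i) * y * s i) := by
        have h1 := hθ.length_map_simple_mul hy i
        have h2 := cs.length_mul_simple y i
        rw [cs.simple_mul_simple_cancel_right]
        omega
      refine ⟨_, conj_mem_twistedIdentities cs hy i, ?_,
        hθ.bruhatLE_conj_left hv (hyb.trans hvle) hi, by omega⟩
      have := hθ.bruhatLE_conj_left (conj_mem_twistedIdentities cs hy i)
        (hay.trans (hθ.bruhatLE_conj_of_ascent hy hyi hyne)) hxi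
      rwa [hcc] at this

theorem IsMaximalChain.mem_of_comparable {u v z : W} {C : Set W}
    (hC : IsMaximalChain cs θ u v C) (hz : z ∈ iotaInterval cs θ u v)
    (h : ∀ c ∈ C, bruhatLE cs z c ∨ bruhatLE cs c z) : z ∈ C := by
  have := hC.2.2 (insert z C) (Set.insert_subset hz hC.1)
    (hC.2.1.insert fun c hc _ => h c hc) (Set.subset_insert z C)
  rw [this]
  exact Set.mem_insert z C

theorem IsMaximalChain.comparable {u v x y : W} {C : Set W}
    (hC : IsMaximalChain cs θ u v C) (hx : x ∈ C) (hy : y ∈ C) :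
    bruhatLE cs x y ∨ bruhatLE cs y x := by
  by_cases h : x = y
  · exact .inl (h ▸ bruhatLE_refl x)
  · exact hC.2.1 hx hy h

theorem IsMaximalChain.exists_length_add_two (hθ : IsDiagramInvolution cs θ) (hNOF : NOF cs θ)
    {u v x : W} {C : Set W} (hC : IsMaximalChain cs θ u v C) (hu : u ∈ C) (hx : x ∈ C)
    (hne : x ≠ u) : ∃ z ∈ C, ℓ z + 2 = ℓ x := by
  have hfin : {y ∈ C | ℓ y < ℓ x}.Finite :=
    (finite_setOf_bruhatLE (cs := cs) v).subset fun y hy => (hC.1 hy.1).2.2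
  have hux : ℓ u < ℓ x := (hC.1 hx).2.1.eq_or_length_lt.resolve_left hne.symm
  obtain ⟨y, ⟨hy, hyx⟩, hmax⟩ := Set.exists_max_image _ cs.length hfin ⟨u, hu, hux⟩
  have hyx' : bruhatLE cs y x :=
    (hC.comparable hy hx).resolve_right fun h => not_lt.mpr h.length_le hyx
  obtain ⟨z, hz, hyz, hzx, hlen⟩ := hθ.exists_coatom hNOF (hC.1 hy).1 (hC.1 hx).1 hyx'
    (fun h => by rw [h] at hyx; exact lt_irrefl _ hyx)
  refine ⟨z, hC.mem_of_comparable
    ⟨hz, (hC.1 hy).2.1.trans hyz, hzx.trans (hC.1 hx).2.2⟩ fun c hc => ?_, hlen⟩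
  rcases hC.comparable hx hc with h | h
  · exact .inl (hzx.trans h)
  · rcases h.eq_or_length_lt with rfl | hlt
    · exact .inl hzx
    · right
      rcases hC.comparable hc hy with h' | h'
      · exact h'.trans hyz
      · obtain rfl := h'.eq_or_length_lt.resolve_right (not_lt.mpr (hmax c ⟨hc, hlt⟩))
        exact hyz

end Coxeter

theorem statement11 [Finite B] (cs : CoxeterSystem M W) (θ : W ≃* W)
    (hθ : Function.Involutive θ)
    (hθS : ∀ i : B, ∃ j : B, θ (cs.simple i) = cs.simple j)
    (hNOF : NOF cs θ)
    (u v : W) (hu : u ∈ twistedIdentities θ) (hv : v ∈ twistedIdentities θ)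
    (huv : bruhatLE cs u v)
    (C : Set W) (hC : IsMaximalChain cs θ u v C) :
    C.ncard = twistRank cs θ v - twistRank cs θ u + 1 := by
  have hdiag : IsDiagramInvolution cs θ := ⟨hθ, hθS⟩
  have hρ : ∀ x ∈ C, 2 * twistRank cs θ x = cs.length x :=
    fun x hx => hdiag.two_mul_twistRank (hC.1 hx).1
  have huC : u ∈ C := hC.mem_of_comparable ⟨hu, bruhatLE_refl u, huv⟩
    fun c hc => .inl (hC.1 hc).2.1
  have hvC : v ∈ C := hC.mem_of_comparable ⟨hv, huv, bruhatLE_refl v⟩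
    fun c hc => .inr (hC.1 hc).2.2
  have hinj : Set.InjOn (twistRank cs θ) C := by
    intro x hx y hy h
    have h1 := hρ x hx
    have h2 := hρ y hy
    rcases hC.comparable hx hy with h | h
    · exact h.eq_or_length_lt.resolve_right (by omega)
    · exact (h.eq_or_length_lt.resolve_right (by omega)).symm
  have hle : ∀ x ∈ C, twistRank cs θ u ≤ twistRank cs θ x ∧
      twistRank cs θ x ≤ twistRank cs θ v := by
    intro x hx
    have h1 := (hC.1 hx).2.1.length_le
    have h2 := (hC.1 hx).2.2.length_le
    have h3 := hρ x hx
    have h4 := hρ u huC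
    have h5 := hρ v hvC
    omega
  have hsurj : ∀ d, twistRank cs θ u + d ≤ twistRank cs θ v →
      ∃ x ∈ C, twistRank cs θ x + d = twistRank cs θ v := by
    intro d
    induction d with
    | zero => exact fun _ => ⟨v, hvC, rfl⟩
    | succ d ih =>
      intro hd
      obtain ⟨x, hx, hxd⟩ := ih (by omega)
      obtain ⟨z, hz, hlen⟩ := hC.exists_length_add_two hdiag hNOF huC hx
        (by rintro rfl; omega)
      have h1 := hρ x hx
      have h2 := hρ z hz
      exact ⟨z, hz, by omega⟩
  have himage : twistRank cs θ '' C = Finset.Icc (twistRank cs θ u) (twistRank cs θ v) := by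
    ext n
    simp only [Set.mem_image, Finset.coe_Icc, Set.mem_Icc]
    constructor
    · rintro ⟨x, hx, rfl⟩
      exact hle x hx
    · rintro ⟨h1, h2⟩
      obtain ⟨x, hx, h⟩ := hsurj (twistRank cs θ v - n) (by omega)
      exact ⟨x, hx, by omega⟩
  rw [← hinj.ncard_image, himage, Set.ncard_coe_finset, Nat.card_Icc]
  have := (hle v hvC).1
  omega

end TwistedIdentitiesPaper
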